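/- Let G : ℝ → ℝ be monotone nondecreasing with G tending to 0 at −∞ and to 1 at +∞, let α be a real number with |α| ≤ 1, and let β > 0. Then the function F(x) = (1 − exp(−β·G(x)·(1 + α − α·G(x))))/(1 − exp(−β)) is monotone nondecreasing on ℝ, takes values in [0,1], tends to 0 at −∞, and tends to 1 at +∞. -/

import Mathlib

/-- The quadratic rank transmutation map `u ↦ u * (1 + α - α * u)` is monotone on `[0, 1]`
when `|α| ≤ 1`. -/
theorem monotoneOn_quadratic_transmutation {α : ℝ} (hα : |α| ≤ 1) :
    MonotoneOn (fun u : ℝ => u * (1 + α - α * u)) (Set.Icc 0 1) := by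
  rintro u ⟨hu0, hu1⟩ v ⟨hv0, hv1⟩ huv
  have hslope : |α * (1 - u - v)| ≤ 1 := by
    rw [abs_mul]
    exact mul_le_one₀ hα (abs_nonneg _) (abs_le.2 ⟨by linarith, by linarith⟩)
  have hprod : 0 ≤ (v - u) * (1 + α * (1 - u - v)) :=
    mul_nonneg (sub_nonneg.2 huv) (by linarith [(abs_le.1 hslope).1])
  change u * (1 + α - α * u) ≤ v * (1 + α - α * v)
  linarith

/-- The truncated-Poisson transform `t ↦ (1 - exp (-β * t)) / (1 - exp (-β))` is monotone
for `β > 0`. -/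
theorem monotone_one_sub_exp_div {β : ℝ} (hβ : 0 < β) :
    Monotone (fun t : ℝ => (1 - Real.exp (-β * t)) / (1 - Real.exp (-β))) := by
  intro s t hst
  have hden : 0 ≤ 1 - Real.exp (-β) := sub_nonneg.2 (Real.exp_le_one_iff.2 (by linarith))
  exact div_le_div_of_nonneg_right
    (sub_le_sub_left (Real.exp_le_exp.2 (mul_le_mul_of_nonpos_left hst (by linarith))) 1) hden

theorem poisson_transmutedG_is_cdf (G : ℝ → ℝ) (hG : Monotone G)
    (hG0 : Filter.Tendsto G Filter.atBot (nhds 0))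
    (hG1 : Filter.Tendsto G Filter.atTop (nhds 1))
    (α : ℝ) (hα : |α| ≤ 1) (β : ℝ) (hβ : 0 < β) :
    Monotone (fun x =>
      (1 - Real.exp (-β * (G x * (1 + α - α * G x)))) / (1 - Real.exp (-β))) ∧
    (∀ x : ℝ,
      (1 - Real.exp (-β * (G x * (1 + α - α * G x)))) / (1 - Real.exp (-β))
        ∈ Set.Icc (0 : ℝ) 1) ∧
    Filter.Tendsto (fun x =>
      (1 - Real.exp (-β * (G x * (1 + α - α * G x)))) / (1 - Real.exp (-β)))
      Filter.atBot (nhds 0) ∧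
    Filter.Tendsto (fun x =>
      (1 - Real.exp (-β * (G x * (1 + α - α * G x)))) / (1 - Real.exp (-β)))
      Filter.atTop (nhds 1) := by
  have hmem : ∀ x, G x ∈ Set.Icc (0 : ℝ) 1 := fun x =>
    ⟨hG.le_of_tendsto hG0 x, hG.ge_of_tendsto hG1 x⟩
  have hden : 1 - Real.exp (-β) ≠ 0 :=
    (sub_pos.2 (Real.exp_lt_one_iff.2 (by linarith))).ne'
  have hmono : Monotone (fun x =>
      (1 - Real.exp (-β * (G x * (1 + α - α * G x)))) / (1 - Real.exp (-β))) := fun x y hxy =>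
    monotone_one_sub_exp_div hβ
      (monotoneOn_quadratic_transmutation hα (hmem x) (hmem y) (hG hxy))
  have hcont : Continuous (fun u : ℝ =>
      (1 - Real.exp (-β * (u * (1 + α - α * u)))) / (1 - Real.exp (-β))) := by
    fun_prop
  have hbot : Filter.Tendsto (fun x =>
      (1 - Real.exp (-β * (G x * (1 + α - α * G x)))) / (1 - Real.exp (-β)))
      Filter.atBot (nhds 0) := by
    simpa [Function.comp_def] using (hcont.tendsto 0).comp hG0
  have htop : Filter.Tendsto (fun x =>
      (1 - Real.exp (-β * (G x * (1 + α - α * G x)))) / (1 - Real.exp (-β)))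
      Filter.atTop (nhds 1) := by
    simpa [Function.comp_def, hden] using (hcont.tendsto 1).comp hG1
  exact ⟨hmono, fun x => ⟨hmono.le_of_tendsto hbot x, hmono.ge_of_tendsto htop x⟩, hbot, htop⟩
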